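/- Let T = (T_1, …, T_N) with X := T_1. Let μ = P + V_0(T) + Σ_{i≥1} V_i(T) P^{−i} be a Laurent series in P^{−1} with smooth coefficients and M := Σ_{n=1}^{N} n T_n μ^{n−1} + Σ_{i≥1} S_i(T) μ^{−i} with smooth S_i. Let f(P,X), g(P,X) be Laurent polynomials in P with coefficients polynomial in X satisfying {f, g} = 1, and suppose f(μ, M)_{≤0} = 0 and g(μ, M)_{≤−1} = 0. Then for each n = 1,…,N the following two identities hold: (∂M/∂X)(∂μ/∂T_n) − (∂μ/∂X)(∂M/∂T_n) = −∂_X( (μ^n)_{≥1} ), and (∂M/∂P)(∂μ/∂T_n) − (∂μ/∂P)(∂M/∂T_n) = −∂_P( (μ^n)_{≥1} ). -/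

import Mathlib

namespace DMKP

/-- Coefficient functions of a formal Laurent series in `P⁻¹` with time variables
`T = (T₁, …, T_N)`: `A n` is the coefficient of `P^n`. -/
abbrev Coeffs (N : ℕ) := ℤ → (Fin N → ℝ) → ℝ

variable {N : ℕ}

/-- Partial derivative in the direction of the `q`-th time variable. -/
noncomputable def pd (q : Fin N) (f : (Fin N → ℝ) → ℝ) : (Fin N → ℝ) → ℝ :=
  fun x => fderiv ℝ f x (Pi.single q 1)

/-- Finitely many positive powers of `P`. -/
def BddPow (A : Coeffs N) : Prop := ∃ m : ℤ, ∀ n : ℤ, m < n → A n = 0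

/-- All coefficients are smooth functions of the time variables. -/
def SmoothCoeffs (A : Coeffs N) : Prop := ∀ n : ℤ, ContDiff ℝ (⊤ : ℕ∞) (A n)

/-- A Laurent series in `P⁻¹` with smooth coefficients. -/
def IsLaurent (A : Coeffs N) : Prop := BddPow A ∧ SmoothCoeffs A

/-- Termwise `∂_P`. -/
def dP (A : Coeffs N) : Coeffs N := fun n x => ((n + 1 : ℤ) : ℝ) * A (n + 1) x

/-- Termwise `∂_{T_q}`. -/
noncomputable def dT (q : Fin N) (A : Coeffs N) : Coeffs N := fun n => pd q (A n)

/-- Termwise `∂_X`, where `X = T₁`. -/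
noncomputable def dX [NeZero N] (A : Coeffs N) : Coeffs N := dT 0 A

/-- Termwise product of Laurent series. -/
noncomputable def mul (A B : Coeffs N) : Coeffs N := fun n x => ∑' i : ℤ, A i x * B (n - i) x

/-- The Poisson bracket `{f,g} = f_P g_X - f_X g_P`. -/
noncomputable def pb [NeZero N] (A B : Coeffs N) : Coeffs N :=
  fun n x => mul (dP A) (dX B) n x - mul (dX A) (dP B) n x

/-- Truncation keeping only powers `P^n` with `n ≥ k`. -/
def truncGe (k : ℤ) (A : Coeffs N) : Coeffs N := fun n => if k ≤ n then A n else 0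

/-- Truncation keeping only powers `P^n` with `n ≤ k`. -/
def truncLe (k : ℤ) (A : Coeffs N) : Coeffs N := fun n => if n ≤ k then A n else 0

/-- The residue: coefficient of `P⁻¹`. -/
def res (A : Coeffs N) : (Fin N → ℝ) → ℝ := A (-1)

/-- The constant Laurent series `1`. -/
def one' : Coeffs N := fun n => if n = 0 then (fun _ => (1 : ℝ)) else 0

/-- `powC A q` is the `q`-th power `A^q`. -/
noncomputable def powC (A : Coeffs N) : ℕ → Coeffs N
  | 0 => one'
  | q + 1 => mul A (powC A q)

/-- `e^{-ad φ} A = Σ_{k≥0} (1/k!) (φ_X)^k ∂_P^k A`. -/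
noncomputable def expAdNeg [NeZero N] (φ : (Fin N → ℝ) → ℝ) (A : Coeffs N) : Coeffs N :=
  fun n x => ∑' k : ℕ, (pd 0 φ x) ^ k / (Nat.factorial k : ℝ) * (dP^[k] A) n x

/-- `e^{ad φ} A = Σ_{k≥0} (1/k!) (-φ_X)^k ∂_P^k A`. -/
noncomputable def expAdPos [NeZero N] (φ : (Fin N → ℝ) → ℝ) (A : Coeffs N) : Coeffs N :=
  fun n x => ∑' k : ℕ, (-(pd 0 φ x)) ^ k / (Nat.factorial k : ℝ) * (dP^[k] A) n x

/-- A `P`-independent function viewed as a Laurent series concentrated at `P^0`. -/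
def const (φ : (Fin N → ℝ) → ℝ) : Coeffs N := fun n => if n = 0 then φ else 0

/-- Evaluation of the polynomial (non-negative) part of `A` at `P = φ_X`. -/
noncomputable def evalAtPhiX [NeZero N] (A : Coeffs N) (φ : (Fin N → ℝ) → ℝ) :
    (Fin N → ℝ) → ℝ :=
  fun x => ∑' k : ℕ, A (k : ℤ) x * (pd 0 φ x) ^ k

/-- The shape `λ = P + U₂ P⁻¹ + U₃ P⁻² + ⋯` of the dKP Lax function. -/
def IsDKPShape (lam : Coeffs N) : Prop :=
  (lam 1 = fun _ => (1 : ℝ)) ∧ lam 0 = 0 ∧ ∀ n : ℤ, 2 ≤ n → lam n = 0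

/-- The shape `μ = P + V₀ + V₁ P⁻¹ + ⋯` of the dmKP Lax function. -/
def IsDMKPShape (mu : Coeffs N) : Prop :=
  (mu 1 = fun _ => (1 : ℝ)) ∧ ∀ n : ℤ, 2 ≤ n → mu n = 0


/-- `μ^j` for `j : ℤ`, given an inverse `μ⁻¹`. -/
noncomputable def zpowPair {N : ℕ} (mu muinv : Coeffs N) (j : ℤ) : Coeffs N :=
  if 0 ≤ j then powC mu j.toNat else powC muinv (-j).toNat

/-- The Orlov function `M = Σ_{n=1}^N n T_n μ^{n-1} + Σ_{i≥1} S_i μ^{-i}` of dmKP. -/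
noncomputable def orlov {N : ℕ} (mu muinv : Coeffs N) (S : ℕ → (Fin N → ℝ) → ℝ) :
    Coeffs N :=
  fun n x => (∑ q : Fin N, (((q : ℕ) + 1 : ℕ) : ℝ) * x q * powC mu (q : ℕ) n x)
    + ∑' i : ℕ, S (i + 1) x * powC muinv (i + 1) n x

/-- A Laurent polynomial `f(P,X) = Σ c_{jk} P^j X^k` (finitely many terms, coefficients
polynomial in `X`) viewed as a Laurent series whose coefficients depend only on `X = T₁`. -/
noncomputable def polyToCoeffs {N : ℕ} [NeZero N] (f : ℤ →₀ Polynomial ℝ) : Coeffs N :=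
  fun n x => (f n).eval (x 0)

/-- Substitution `P ↦ μ`, `X ↦ M` into a Laurent polynomial `f(P,X)`. -/
noncomputable def substC {N : ℕ} (f : ℤ →₀ Polynomial ℝ) (mu muinv M : Coeffs N) :
    Coeffs N :=
  fun n x => ∑ j ∈ f.support, ∑ k ∈ (f j).support,
    (f j).coeff k * mul (zpowPair mu muinv j) (powC M k) n x

open Polynomial LaurentPolynomial

/-- Formal `∂_P` on Laurent polynomials in `P` with coefficients polynomial in `X`. -/
noncomputable def laurentDerivP : ℝ[X][T;T⁻¹] →+ ℝ[X][T;T⁻¹] where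
  toFun p := p.coeff.sum fun n r => .single (n - 1) (n • r)
  map_zero' := by simp
  map_add' p q := by
    rw [AddMonoidAlgebra.coeff_add, Finsupp.sum_add_index' (by simp)]
    intro n a b
    rw [smul_add, AddMonoidAlgebra.single_add]

/-- Formal `∂_X` on Laurent polynomials in `P` with coefficients polynomial in `X`. -/
noncomputable def laurentDerivX : ℝ[X][T;T⁻¹] →+ ℝ[X][T;T⁻¹] where
  toFun p := p.coeff.sum fun n r => .single n (derivative r)
  map_zero' := by simp
  map_add' p q := by
    rw [AddMonoidAlgebra.coeff_add, Finsupp.sum_add_index' (by simp)]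
    intro n a b
    rw [derivative_add, AddMonoidAlgebra.single_add]

theorem laurentDerivP_single (n : ℤ) (r : ℝ[X]) :
    laurentDerivP (.single n r) = .single (n - 1) (n • r) := by
  rw [laurentDerivP, AddMonoidHom.coe_mk, ZeroHom.coe_mk, AddMonoidAlgebra.coeff_single,
    Finsupp.sum_single_index (by simp)]

theorem laurentDerivX_single (n : ℤ) (r : ℝ[X]) :
    laurentDerivX (.single n r) = .single n (derivative r) := by
  rw [laurentDerivX, AddMonoidHom.coe_mk, ZeroHom.coe_mk, AddMonoidAlgebra.coeff_single,
    Finsupp.sum_single_index (by simp)]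

theorem coeff_laurentDerivP (p : ℝ[X][T;T⁻¹]) (n : ℤ) :
    (laurentDerivP p).coeff n = (n + 1) • p.coeff (n + 1) := by
  induction p using AddMonoidAlgebra.induction_linear with
  | zero => simp
  | add p q hp hq => rw [map_add, AddMonoidAlgebra.coeff_add, AddMonoidAlgebra.coeff_add,
      Finsupp.add_apply, Finsupp.add_apply, hp, hq, smul_add]
  | single m r =>
    rw [laurentDerivP_single, AddMonoidAlgebra.coeff_single, AddMonoidAlgebra.coeff_single,
      Finsupp.single_apply, Finsupp.single_apply]
    by_cases h : m = n + 1
    · rw [if_pos (by omega), if_pos h, h]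
    · rw [if_neg (by omega), if_neg h, smul_zero]

theorem coeff_laurentDerivX (p : ℝ[X][T;T⁻¹]) (n : ℤ) :
    (laurentDerivX p).coeff n = derivative (p.coeff n) := by
  induction p using AddMonoidAlgebra.induction_linear with
  | zero => simp
  | add p q hp hq => rw [map_add, AddMonoidAlgebra.coeff_add, AddMonoidAlgebra.coeff_add,
      Finsupp.add_apply, Finsupp.add_apply, hp, hq, derivative_add]
  | single m r =>
    rw [laurentDerivX_single, AddMonoidAlgebra.coeff_single, AddMonoidAlgebra.coeff_single,
      Finsupp.single_apply, Finsupp.single_apply]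
    split_ifs <;> simp

theorem coeff_mul_eq_tsum (p q : ℝ[X][T;T⁻¹]) (n : ℤ) (t : ℝ) :
    ((p * q).coeff n).eval t = ∑' i : ℤ, (p.coeff i).eval t * (q.coeff (n - i)).eval t := by
  rw [AddMonoidAlgebra.coeff_mul_apply_left, Finsupp.sum, eval_finsetSum,
    tsum_eq_sum (s := p.coeff.support)]
  · refine Finset.sum_congr rfl fun i _ => ?_
    rw [eval_mul, neg_add_eq_sub]
  · intro i hi
    rw [Finsupp.notMem_support_iff.mp hi, eval_zero, zero_mul]

section Substitution

variable {A : Type*} [CommRing A] [Algebra ℝ A]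

theorem derivation_unit_zpow (D : Derivation ℝ A A) (u : Aˣ) (j : ℤ) :
    D ((u ^ j : Aˣ) : A) = j * ((u ^ (j - 1) : Aˣ) : A) * D u := by
  have hneg : D ((u⁻¹ : Aˣ) : A) = -((u⁻¹ : Aˣ) : A) ^ 2 * D u := by
    simpa using D.leibniz_of_mul_eq_one (a := ((u⁻¹ : Aˣ) : A)) (b := u) (by simp)
  induction j using Int.induction_on with
  | zero => simp
  | succ i ih =>
    have h1 : ((u ^ (i : ℤ) : Aˣ) : A) = ((u ^ ((i : ℤ) - 1) : Aˣ) : A) * u := by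
      rw [← Units.val_mul, ← zpow_add_one]; simp
    rw [zpow_add_one, Units.val_mul, D.leibniz, ih, add_sub_cancel_right, smul_eq_mul,
      smul_eq_mul, h1]
    push_cast
    ring
  | pred i ih =>
    have h1 : ((u ^ (-(i : ℤ) - 1 - 1) : Aˣ) : A)
        = ((u ^ (-(i : ℤ) - 1) : Aˣ) : A) * ((u⁻¹ : Aˣ) : A) := by
      rw [← Units.val_mul, ← zpow_sub_one]
    have h2 : ((u ^ (-(i : ℤ) - 1) : Aˣ) : A)
        = ((u ^ (-(i : ℤ)) : Aˣ) : A) * ((u⁻¹ : Aˣ) : A) := by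
      rw [← Units.val_mul, ← zpow_sub_one]
    rw [h1]
    conv_lhs => rw [h2, D.leibniz, ih, hneg, smul_eq_mul, smul_eq_mul]
    rw [h2]
    push_cast
    ring

/-- Substitution `P ↦ u`, `X ↦ m` as a ring homomorphism. -/
noncomputable def laurentSubst (u : Aˣ) (m : A) : ℝ[X][T;T⁻¹] →+* A :=
  LaurentPolynomial.eval₂ (aeval m : ℝ[X] →ₐ[ℝ] A).toRingHom u

theorem laurentSubst_single (u : Aˣ) (m : A) (j : ℤ) (r : ℝ[X]) :
    laurentSubst u m (.single j r) = aeval m r * ((u ^ j : Aˣ) : A) := by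
  rw [single_eq_C_mul_T]
  exact eval₂_C_mul_T _ _ _ _

theorem derivation_laurentSubst (D : Derivation ℝ A A) (u : Aˣ) (m : A) (p : ℝ[X][T;T⁻¹]) :
    D (laurentSubst u m p) =
      laurentSubst u m (laurentDerivP p) * D u + laurentSubst u m (laurentDerivX p) * D m := by
  induction p using AddMonoidAlgebra.induction_linear with
  | zero => simp
  | add p q hp hq => simp only [map_add, hp, hq]; ring
  | single j r =>
    rw [laurentDerivP_single, laurentDerivX_single, laurentSubst_single, laurentSubst_single,
      laurentSubst_single, D.leibniz, D.map_aeval, derivation_unit_zpow, smul_eq_mul, smul_eq_mul,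
      smul_eq_mul, map_zsmul, zsmul_eq_mul]
    ring

theorem jacobian_laurentSubst (D E : Derivation ℝ A A) (u : Aˣ) (m : A) (p q : ℝ[X][T;T⁻¹])
    (h : laurentDerivP p * laurentDerivX q - laurentDerivX p * laurentDerivP q = 1) :
    D m * E u - D u * E m
      = D (laurentSubst u m q) * E (laurentSubst u m p)
        - D (laurentSubst u m p) * E (laurentSubst u m q) := by
  have h' := congrArg (laurentSubst u m) h
  rw [map_sub, map_mul, map_mul, map_one] at h'
  simp only [derivation_laurentSubst]
  linear_combination (D u * E m - D m * E u) * h'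

/-- The multiple `c D` of a derivation. -/
def mulDerivation (c : A) (D : Derivation ℝ A A) : Derivation ℝ A A := c • D

theorem mulDerivation_apply (c : A) (D : Derivation ℝ A A) (a : A) :
    mulDerivation c D a = c * D a := rfl

/-- The part `Σ n T_n μ^{n-1}` of the Orlov function, with times `t` and Lax function `u`. -/
def orlovPoly (t : Fin N → A) (u : A) : A :=
  ∑ r : Fin N, (((r : ℕ) + 1 : ℕ) : A) * (t r * u ^ (r : ℕ))

theorem derivation_orlovPoly (D : Derivation ℝ A A) (t : Fin N → A) (u : A) :
    D (orlovPoly t u) =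
      (∑ r : Fin N, (((r : ℕ) + 1 : ℕ) : A) * (t r * ((r : ℕ) * u ^ ((r : ℕ) - 1)))) * D u
        + ∑ r : Fin N, (((r : ℕ) + 1 : ℕ) : A) * u ^ (r : ℕ) * D (t r) := by
  rw [orlovPoly, map_sum, Finset.sum_mul, ← Finset.sum_add_distrib]
  refine Finset.sum_congr rfl fun r _ => ?_
  rw [D.leibniz, D.leibniz, D.leibniz_pow, D.map_natCast]
  simp only [smul_eq_mul, nsmul_eq_mul]
  ring

theorem orlovPoly_bracket_time (D E : Derivation ℝ A A) (t : Fin N → A) (u s : A) (p q : Fin N)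
    (hD : ∀ r, D (t r) = if p = r then 1 else 0) (hE : ∀ r, E (t r) = if q = r then 1 else 0) :
    D (orlovPoly t u + s) * E u - D u * E (orlovPoly t u + s) + D (u ^ ((q : ℕ) + 1))
      = E (u ^ ((p : ℕ) + 1)) + (D s * E u - D u * E s) := by
  rw [map_add, map_add, derivation_orlovPoly, derivation_orlovPoly, D.leibniz_pow, E.leibniz_pow]
  simp only [hD, hE, mul_ite, mul_one, mul_zero, Finset.sum_ite_eq, Finset.mem_univ, if_true,
    smul_eq_mul, nsmul_eq_mul, Nat.add_sub_cancel]
  ring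

theorem orlovPoly_bracket_const (D E : Derivation ℝ A A) (t : Fin N → A) (u s : A) (q : Fin N)
    (hD : ∀ r, D (t r) = 0) (hE : ∀ r, E (t r) = if q = r then 1 else 0) :
    D (orlovPoly t u + s) * E u - D u * E (orlovPoly t u + s) + D (u ^ ((q : ℕ) + 1))
      = D s * E u - D u * E s := by
  rw [map_add, map_add, derivation_orlovPoly, derivation_orlovPoly, D.leibniz_pow]
  simp only [hD, hE, mul_ite, mul_one, mul_zero, Finset.sum_ite_eq, Finset.mem_univ, if_true,
    smul_eq_mul, nsmul_eq_mul, Nat.add_sub_cancel, Finset.sum_const_zero]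
  ring

end Substitution

theorem dX_polyToCoeffs [NeZero N] (f : ℤ →₀ ℝ[X]) (n : ℤ) (x : Fin N → ℝ) :
    dX (polyToCoeffs f) n x = (derivative (f n)).eval (x 0) := by
  have h := ((f n).hasDerivAt (x 0)).comp_hasFDerivAt x
    (hasFDerivAt_apply (𝕜 := ℝ) (F' := fun _ : Fin N => ℝ) 0 x)
  change fderiv ℝ ((fun t => (f n).eval t) ∘ fun y : Fin N → ℝ => y 0) x (Pi.single 0 1) = _
  rw [h.fderiv]
  simp

theorem laurentDeriv_bracket_eq_one [NeZero N] (f g : ℤ →₀ ℝ[X])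
    (h : pb (polyToCoeffs (N := N) f) (polyToCoeffs g) = one') :
    laurentDerivP (.ofCoeff f) * laurentDerivX (.ofCoeff g)
      - laurentDerivX (.ofCoeff f) * laurentDerivP (.ofCoeff g) = 1 := by
  refine LaurentPolynomial.ext fun n => Polynomial.funext fun t => ?_
  have hn := congrFun (congrFun h n) (fun _ => t)
  have hP : ∀ (p : ℤ →₀ ℝ[X]) (i : ℤ), ((laurentDerivP (.ofCoeff p)).coeff i).eval t
      = dP (polyToCoeffs (N := N) p) i (fun _ => t) := by
    intro p i
    simp [coeff_laurentDerivP, dP, polyToCoeffs, eval_mul]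
  have hX : ∀ (p : ℤ →₀ ℝ[X]) (i : ℤ), ((laurentDerivX (.ofCoeff p)).coeff i).eval t
      = dX (polyToCoeffs (N := N) p) i (fun _ => t) := by
    intro p i
    rw [dX_polyToCoeffs, coeff_laurentDerivX]
  rw [AddMonoidAlgebra.coeff_sub, Finsupp.sub_apply, eval_sub, coeff_mul_eq_tsum,
    coeff_mul_eq_tsum]
  simp only [hP, hX]
  refine hn.trans ?_
  rw [AddMonoidAlgebra.one_def, AddMonoidAlgebra.coeff_single, Finsupp.single_apply, one']
  by_cases h0 : n = 0
  · simp [h0]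
  · simp [h0, Ne.symm h0]

section HahnSeriesDerivation

variable {R : Type*} [CommRing R] [Algebra ℝ R]

/-- The coefficientwise algebra structure, preferred to the one through power series. -/
noncomputable instance hahnSeriesAlgebra : Algebra ℝ (HahnSeries ℤ R) :=
  HahnSeries.instAlgebra

/-- A family of linear maps satisfying a graded Leibniz rule acts termwise on Hahn series as a
derivation. -/
noncomputable def termwiseDerivation (d : ℤ → R →ₗ[ℝ] R)
    (hd : ∀ i j a b, d (i + j) (a * b) = a * d j b + b * d i a) :
    Derivation ℝ (HahnSeries ℤ R) (HahnSeries ℤ R) :=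
  let D : HahnSeries ℤ R →ₗ[ℝ] HahnSeries ℤ R :=
    { toFun := fun A =>
        { coeff := fun n => d n (A.coeff n)
          isPWO_support' := A.isPWO_support.mono fun n hn h => hn (by simp [h]) }
      map_add' := fun A B => by ext n; simp
      map_smul' := fun c A => by ext n; simp }
  Derivation.mk' D fun A B => by
    have hsub : ∀ A : HahnSeries ℤ R, (D A).support ⊆ A.support := fun A n hn h =>
      hn (show d n (A.coeff n) = 0 by rw [h, map_zero])
    ext n
    rw [smul_eq_mul, smul_eq_mul, mul_comm B, HahnSeries.coeff_add,
      HahnSeries.coeff_mul_right' B.isPWO_support (hsub B),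
      HahnSeries.coeff_mul_left' A.isPWO_support (hsub A), ← Finset.sum_add_distrib]
    change d n ((A * B).coeff n) = _
    rw [HahnSeries.coeff_mul, map_sum]
    refine Finset.sum_congr rfl fun ij hij => ?_
    rw [Finset.mem_antidiagonal] at hij
    rw [← hij.2.2, hd, mul_comm (B.coeff _)]
    rfl

end HahnSeriesDerivation

/-- Smooth functions of the time variables. -/
def smoothFun (N : ℕ) : Subalgebra ℝ ((Fin N → ℝ) → ℝ) where
  carrier := {f | ContDiff ℝ (⊤ : ℕ∞) f}
  mul_mem' {f g} (hf : ContDiff ℝ _ f) (hg : ContDiff ℝ _ g) :=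
    show ContDiff ℝ (⊤ : ℕ∞) fun x => f x * g x from hf.mul hg
  add_mem' {f g} (hf : ContDiff ℝ _ f) (hg : ContDiff ℝ _ g) :=
    show ContDiff ℝ (⊤ : ℕ∞) fun x => f x + g x from hf.add hg
  algebraMap_mem' c := show ContDiff ℝ (⊤ : ℕ∞) fun _ : Fin N → ℝ => c from contDiff_const

theorem differentiable_of_mem_smoothFun (f : smoothFun N) : Differentiable ℝ f.1 :=
  ContDiff.differentiable (n := (⊤ : ℕ∞)) f.2 (by simp)

/-- The partial derivative as a linear map on smooth functions. -/
noncomputable def smoothPd (q : Fin N) : smoothFun N →ₗ[ℝ] smoothFun N where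
  toFun f := ⟨pd q f.1, ((show ContDiff ℝ (⊤ : ℕ∞) f.1 from f.2).fderiv_right
    (m := (⊤ : ℕ∞)) (by simp)).clm_apply contDiff_const⟩
  map_add' f g := by
    ext x
    change fderiv ℝ (f.1 + g.1) x _ = fderiv ℝ f.1 x _ + fderiv ℝ g.1 x _
    rw [fderiv_add (differentiable_of_mem_smoothFun f x) (differentiable_of_mem_smoothFun g x)]
    rfl
  map_smul' c f := by
    ext x
    change fderiv ℝ (c • f.1) x _ = c • fderiv ℝ f.1 x _
    rw [fderiv_const_smul (differentiable_of_mem_smoothFun f x)]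
    rfl

theorem smoothPd_mul (q : Fin N) (f g : smoothFun N) :
    smoothPd q (f * g) = f * smoothPd q g + g * smoothPd q f := by
  ext x
  change fderiv ℝ (f.1 * g.1) x _ = f.1 x * fderiv ℝ g.1 x _ + g.1 x * fderiv ℝ f.1 x _
  rw [fderiv_mul (differentiable_of_mem_smoothFun f x) (differentiable_of_mem_smoothFun g x)]
  simp

/-- The ring of Laurent series in `P⁻¹` with smooth coefficients; the Hahn series exponent is
minus the exponent of `P`. -/
def SmoothSeries (N : ℕ) := HahnSeries ℤ (smoothFun N)

noncomputable instance : CommRing (SmoothSeries N) :=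
  inferInstanceAs (CommRing (HahnSeries ℤ (smoothFun N)))

noncomputable instance : Algebra ℝ (SmoothSeries N) :=
  hahnSeriesAlgebra (R := smoothFun N)

/-- The coefficient functions of a Laurent series. -/
def toCoeffs : SmoothSeries N →ₗ[ℝ] Coeffs N where
  toFun A n := (A.coeff (-n)).1
  map_add' _ _ := rfl
  map_smul' _ _ := rfl

theorem toCoeffs_apply (A : SmoothSeries N) (n : ℤ) : toCoeffs A n = (A.coeff (-n)).1 := rfl

/-- Termwise `∂_{T_q}` as a derivation. -/
noncomputable def derivT (q : Fin N) : Derivation ℝ (SmoothSeries N) (SmoothSeries N) :=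
  termwiseDerivation (fun _ => smoothPd q) fun _ _ => smoothPd_mul q

/-- The Euler operator `P ∂_P` as a derivation. -/
noncomputable def derivEuler : Derivation ℝ (SmoothSeries N) (SmoothSeries N) :=
  termwiseDerivation (fun n => (-(n : ℝ)) • (LinearMap.id : smoothFun N →ₗ[ℝ] smoothFun N))
    fun i j a b => by
      ext x
      simp
      ring

/-- The Laurent series `P⁻¹`. -/
noncomputable def invP : SmoothSeries N := HahnSeries.single (1 : ℤ) (1 : smoothFun N)

/-- Termwise `∂_P` as a derivation. -/
noncomputable def derivP : Derivation ℝ (SmoothSeries N) (SmoothSeries N) :=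
  mulDerivation invP derivEuler

theorem toCoeffs_injective : Function.Injective (toCoeffs (N := N)) := fun A B h =>
  HahnSeries.ext <| funext fun n => Subtype.ext <| by
    have hn := congrFun h (-n)
    rwa [toCoeffs_apply, toCoeffs_apply, neg_neg] at hn

theorem toCoeffs_derivEuler (A : SmoothSeries N) (n : ℤ) (x : Fin N → ℝ) :
    toCoeffs (derivEuler A) n x = n * toCoeffs A n x := by
  change (-((-n : ℤ) : ℝ)) * (A.coeff (-n)).1 x = _
  rw [Int.cast_neg, neg_neg]
  rfl

theorem toCoeffs_invP_mul (A : SmoothSeries N) (n : ℤ) :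
    toCoeffs (invP * A) n = toCoeffs A (n + 1) := by
  have h : ∀ B : HahnSeries ℤ (smoothFun N),
      (HahnSeries.single (1 : ℤ) (1 : smoothFun N) * B).coeff (-n) = B.coeff (-(n + 1)) := by
    intro B
    rw [HahnSeries.coeff_single_mul, one_mul, show -n - 1 = -(n + 1) by ring]
  exact congrArg Subtype.val (h A)

theorem toCoeffs_derivT (q : Fin N) (A : SmoothSeries N) :
    toCoeffs (derivT q A) = dT q (toCoeffs A) := rfl

theorem toCoeffs_derivP (A : SmoothSeries N) : toCoeffs (derivP A) = dP (toCoeffs A) := by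
  ext n x
  rw [derivP, mulDerivation_apply, toCoeffs_invP_mul, toCoeffs_derivEuler, dP]

theorem coeff_mul_apply_eq_tsum (A B : HahnSeries ℤ (smoothFun N)) (n : ℤ) (x : Fin N → ℝ) :
    ((A * B).coeff (-n)).1 x = ∑' i : ℤ, (A.coeff (-i)).1 x * (B.coeff (-(n - i))).1 x := by
  rw [HahnSeries.coeff_mul,
    tsum_eq_sum (s := (Finset.antidiagonal A.isPWO_support B.isPWO_support (-n)).image
      fun ij => -ij.1)]
  · rw [Finset.sum_image, AddSubmonoidClass.coe_finsetSum, Finset.sum_apply]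
    · refine Finset.sum_congr rfl fun ij hij => ?_
      rw [Finset.mem_antidiagonal] at hij
      have h : -(n - -ij.1) = ij.2 := by linarith [hij.2.2]
      rw [h, neg_neg]
      rfl
    · intro a ha b hb hab
      rw [Finset.mem_coe, Finset.mem_antidiagonal] at ha hb
      have h1 : a.1 = b.1 := neg_injective hab
      exact Prod.ext h1 (by linarith [ha.2.2, hb.2.2])
  · intro i hi
    by_contra hne
    refine hi (Finset.mem_image.mpr ⟨(-i, -(n - i)), ?_, by simp⟩)
    rw [Finset.mem_antidiagonal]
    refine ⟨fun h => hne ?_, fun h => hne ?_, by ring⟩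
    · rw [h]; simp
    · rw [h]; simp

theorem toCoeffs_mul (A B : SmoothSeries N) :
    toCoeffs (A * B) = mul (toCoeffs A) (toCoeffs B) :=
  funext fun n => funext fun x => coeff_mul_apply_eq_tsum A B n x

theorem toCoeffs_one : toCoeffs (1 : SmoothSeries N) = one' := by
  ext n x
  change ((1 : HahnSeries ℤ (smoothFun N)).coeff (-n)).1 x = _
  by_cases h : n = 0 <;> simp [one', HahnSeries.coeff_one, h]

theorem toCoeffs_pow (A : SmoothSeries N) (k : ℕ) :
    toCoeffs (A ^ k) = powC (toCoeffs A) k := by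
  induction k with
  | zero => rw [pow_zero, toCoeffs_one, powC]
  | succ k ih => rw [pow_succ', toCoeffs_mul, ih, powC]

theorem IsLaurent.exists_toCoeffs_eq {A : Coeffs N} (hA : IsLaurent A) :
    ∃ a : SmoothSeries N, toCoeffs a = A := by
  obtain ⟨⟨m, hm⟩, hs⟩ := hA
  refine ⟨HahnSeries.ofSuppBddBelow (fun n => ⟨A (-n), hs (-n)⟩)
    ⟨-m, fun n hn => ?_⟩, ?_⟩
  · by_contra h
    exact hn (Subtype.ext (hm (-n) (by omega)))
  · ext n x
    change A (- -n) x = A n x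
    rw [neg_neg]

/-- `A` has no powers of `P` above `m`. -/
def DegLE (m : ℤ) (A : Coeffs N) : Prop := ∀ n, m < n → A n = 0

/-- `A` has no powers of `P` below `m`. -/
def DegGE (m : ℤ) (A : Coeffs N) : Prop := ∀ n, n < m → A n = 0

theorem DegLE.mul {a b : ℤ} {A B : Coeffs N} (hA : DegLE a A) (hB : DegLE b B) :
    DegLE (a + b) (DMKP.mul A B) := by
  intro n hn
  ext x
  refine (tsum_congr fun i => ?_).trans tsum_zero
  rcases lt_or_ge a i with h | h
  · simp [hA i h]
  · simp [hB (n - i) (by omega)]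

theorem DegGE.mul {a b : ℤ} {A B : Coeffs N} (hA : DegGE a A) (hB : DegGE b B) :
    DegGE (a + b) (DMKP.mul A B) := by
  intro n hn
  ext x
  refine (tsum_congr fun i => ?_).trans tsum_zero
  rcases lt_or_ge i a with h | h
  · simp [hA i h]
  · simp [hB (n - i) (by omega)]

theorem DegLE.add {a : ℤ} {A B : Coeffs N} (hA : DegLE a A) (hB : DegLE a B) :
    DegLE a (A + B) := fun n hn => by rw [Pi.add_apply, hA n hn, hB n hn, add_zero]

theorem DegLE.sub {a : ℤ} {A B : Coeffs N} (hA : DegLE a A) (hB : DegLE a B) :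
    DegLE a (A - B) := fun n hn => by rw [Pi.sub_apply, hA n hn, hB n hn, sub_zero]

theorem DegGE.sub {a : ℤ} {A B : Coeffs N} (hA : DegGE a A) (hB : DegGE a B) :
    DegGE a (A - B) := fun n hn => by rw [Pi.sub_apply, hA n hn, hB n hn, sub_zero]

theorem DegLE.mono {a b : ℤ} {A : Coeffs N} (hA : DegLE a A) (hab : a ≤ b) : DegLE b A :=
  fun n hn => hA n (hab.trans_lt hn)

theorem pd_zero (q : Fin N) : pd q 0 = 0 := by
  ext x
  change fderiv ℝ (0 : (Fin N → ℝ) → ℝ) x _ = 0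
  simp

theorem DegLE.dT {a : ℤ} {A : Coeffs N} (q : Fin N) (hA : DegLE a A) : DegLE a (dT q A) :=
  fun n hn => by rw [DMKP.dT, hA n hn, pd_zero]

theorem DegGE.dT {a : ℤ} {A : Coeffs N} (q : Fin N) (hA : DegGE a A) : DegGE a (dT q A) :=
  fun n hn => by rw [DMKP.dT, hA n hn, pd_zero]

theorem DegLE.dP {a b : ℤ} {A : Coeffs N} (hA : DegLE a A) (hab : a ≤ b + 1) : DegLE b (dP A) :=
  fun n hn => by ext x; simp [DMKP.dP, hA (n + 1) (by omega)]

theorem DegGE.dP {a b : ℤ} {A : Coeffs N} (hA : DegGE a A) (hab : b + 1 ≤ a) : DegGE b (dP A) :=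
  fun n hn => by ext x; simp [DMKP.dP, hA (n + 1) (by omega)]

theorem DegLE.powC {a : ℤ} {A : Coeffs N} (hA : DegLE a A) (k : ℕ) :
    DegLE (k * a) (powC A k) := by
  induction k with
  | zero => intro n hn; ext x; simp [DMKP.powC, one', show n ≠ 0 by intro h; simp [h] at hn]
  | succ k ih =>
    have h := hA.mul ih
    rwa [show a + (k : ℤ) * a = ((k + 1 : ℕ) : ℤ) * a by push_cast; ring] at h

theorem IsDMKPShape.degLE_inv {mu muinv : Coeffs N} (hshape : IsDMKPShape mu)
    (hb : BddPow muinv) (hinv : mul mu muinv = one') : DegLE (-1) muinv := by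
  obtain ⟨m, hm⟩ := hb
  have key : ∀ k : ℕ, DegLE (max (-1) (m - k)) muinv := by
    intro k
    induction k with
    | zero => exact fun n hn => hm n (by omega)
    | succ k ih =>
      intro n hn
      by_cases h : max (-1) (m - k) < n
      · exact ih n h
      · ext x
        have h1 := congrFun (congrFun hinv (n + 1)) x
        rw [mul, tsum_eq_single 1] at h1
        · simpa [hshape.1, one', show n + 1 ≠ 0 by omega] using h1
        · intro i hi
          rcases lt_or_gt_of_ne hi with hlt | hgt
          · simp [ih (n + 1 - i) (by omega)]
          · simp [hshape.2 i (by omega)]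
  intro n hn
  exact key (m + 1).toNat n (by omega)

theorem toCoeffs_units_zpow (u : (SmoothSeries N)ˣ) (j : ℤ) :
    toCoeffs ((u ^ j : (SmoothSeries N)ˣ) : SmoothSeries N)
      = zpowPair (toCoeffs u) (toCoeffs ((u⁻¹ : (SmoothSeries N)ˣ) : SmoothSeries N)) j := by
  rw [zpowPair]
  split_ifs with h
  · lift j to ℕ using h
    rw [zpow_natCast, Units.val_pow_eq_pow_val, toCoeffs_pow, Int.toNat_natCast]
  · obtain ⟨k, rfl⟩ : ∃ k : ℕ, j = -(k : ℤ) := ⟨(-j).toNat, by omega⟩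
    rw [neg_neg, zpow_neg, zpow_natCast, ← inv_pow, Units.val_pow_eq_pow_val, toCoeffs_pow,
      Int.toNat_natCast]

theorem toCoeffs_laurentSubst (u : (SmoothSeries N)ˣ) (m : SmoothSeries N) (f : ℤ →₀ ℝ[X]) :
    toCoeffs (laurentSubst u m (.ofCoeff f))
      = substC f (toCoeffs u) (toCoeffs ((u⁻¹ : (SmoothSeries N)ˣ) : SmoothSeries N))
          (toCoeffs m) := by
  have hf : (AddMonoidAlgebra.ofCoeff f : ℝ[X][T;T⁻¹])
      = ∑ j ∈ f.support, AddMonoidAlgebra.single j (f j) :=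
    (AddMonoidAlgebra.sum_coeff_single (AddMonoidAlgebra.ofCoeff f)).symm
  ext n x
  rw [hf, map_sum, map_sum, substC, Finset.sum_apply, Finset.sum_apply]
  refine Finset.sum_congr rfl fun j _ => ?_
  rw [laurentSubst_single, aeval_def, eval₂_eq_sum, Polynomial.sum, Finset.sum_mul, map_sum,
    Finset.sum_apply, Finset.sum_apply]
  refine Finset.sum_congr rfl fun k _ => ?_
  rw [← Algebra.smul_def, smul_mul_assoc, map_smul, mul_comm, toCoeffs_mul, toCoeffs_pow,
    toCoeffs_units_zpow]
  rfl

/-- The time variable `T_q` as a Laurent series. -/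
noncomputable def timeVar (q : Fin N) : SmoothSeries N :=
  HahnSeries.single 0 ⟨fun x => x q, show ContDiff ℝ (⊤ : ℕ∞) fun x : Fin N → ℝ => x q from
    contDiff_apply ℝ ℝ q⟩

theorem toCoeffs_timeVar (q : Fin N) (n : ℤ) :
    toCoeffs (timeVar q) n = if n = 0 then (fun x : Fin N → ℝ => x q) else 0 := by
  change ((HahnSeries.single 0 _ : HahnSeries ℤ (smoothFun N)).coeff (-n)).1 = _
  rw [HahnSeries.coeff_single]
  by_cases h : n = 0
  · rw [if_pos (by omega), if_pos h]
  · rw [if_neg (by omega), if_neg h]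
    rfl

theorem derivT_timeVar (q r : Fin N) :
    derivT q (timeVar r) = if q = r then 1 else 0 := by
  refine toCoeffs_injective (funext fun n => ?_)
  rw [toCoeffs_derivT, dT, toCoeffs_timeVar, apply_ite toCoeffs, toCoeffs_one, map_zero]
  by_cases hn : n = 0
  · ext x
    rw [if_pos hn]
    change fderiv ℝ (fun x : Fin N → ℝ => x r) x (Pi.single q 1) = _
    rw [(hasFDerivAt_apply (𝕜 := ℝ) (F' := fun _ : Fin N => ℝ) r x).fderiv]
    by_cases h : q = r
    · subst h
      simp [hn, one']
    · simp [h, Ne.symm h]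
  · rw [if_neg hn, pd_zero]
    split_ifs <;> simp [one', hn]

theorem derivP_timeVar (q : Fin N) : derivP (timeVar q) = 0 := by
  refine toCoeffs_injective (funext fun n => funext fun x => ?_)
  rw [toCoeffs_derivP, dP, toCoeffs_timeVar, map_zero]
  by_cases hn : n + 1 = 0 <;> simp [hn]

theorem toCoeffs_timeVar_mul (q : Fin N) (A : SmoothSeries N) (n : ℤ) (x : Fin N → ℝ) :
    toCoeffs (timeVar q * A) n x = x q * toCoeffs A n x := by
  rw [toCoeffs_mul, mul, tsum_eq_single 0]
  · rw [toCoeffs_timeVar, if_pos rfl, sub_zero]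
  · intro i hi
    rw [toCoeffs_timeVar, if_neg hi, Pi.zero_apply, zero_mul]

theorem isLaurent_tsum_smul_powC {muinv : Coeffs N} (hmuinv : IsLaurent muinv)
    (hdeg : DegLE (-1) muinv) {S : ℕ → (Fin N → ℝ) → ℝ} (hS : ∀ i, ContDiff ℝ (⊤ : ℕ∞) (S i)) :
    IsLaurent (fun (n : ℤ) (x : Fin N → ℝ) => ∑' i : ℕ, S (i + 1) x * powC muinv (i + 1) n x) ∧
      DegLE (-1) (fun (n : ℤ) (x : Fin N → ℝ) =>
        ∑' i : ℕ, S (i + 1) x * powC muinv (i + 1) n x) := by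
  have hpow : ∀ (i : ℕ) (n : ℤ), -((i : ℤ) + 1) < n → powC muinv (i + 1) n = 0 := fun i n hn =>
    hdeg.powC (i + 1) n (by push_cast; omega)
  have hle : DegLE (-1) (fun (n : ℤ) (x : Fin N → ℝ) =>
      ∑' i : ℕ, S (i + 1) x * powC muinv (i + 1) n x) := by
    intro n hn
    ext x
    refine (tsum_congr fun i => ?_).trans tsum_zero
    rw [hpow i n (by omega), Pi.zero_apply, mul_zero]
  refine ⟨⟨⟨-1, hle⟩, fun n => ?_⟩, hle⟩
  obtain ⟨a, rfl⟩ := hmuinv.exists_toCoeffs_eq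
  have hsum : (fun x => ∑' i : ℕ, S (i + 1) x * powC (toCoeffs a) (i + 1) n x)
      = fun x => ∑ i ∈ Finset.range (-n).toNat,
          S (i + 1) x * powC (toCoeffs a) (i + 1) n x := by
    ext x
    refine tsum_eq_sum fun i hi => ?_
    rw [hpow i n (by rw [Finset.mem_range] at hi; omega), Pi.zero_apply, mul_zero]
  change ContDiff ℝ (⊤ : ℕ∞) fun x => ∑' i : ℕ, S (i + 1) x * powC (toCoeffs a) (i + 1) n x
  rw [hsum]
  refine ContDiff.sum fun i _ => (hS _).mul ?_
  rw [← toCoeffs_pow]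
  exact ((a ^ (i + 1)).coeff (-n)).2

theorem orlov_bracket_time [NeZero N] (q : Fin N)
    {a m s F G : SmoothSeries N}
    (ha : ∀ r : Fin N, DegLE 0 (toCoeffs (derivT r a)))
    (hs : DegLE (-1) (toCoeffs s)) (hm : m = orlovPoly timeVar a + s)
    (hF : DegGE 1 (toCoeffs F)) (hG : DegGE 0 (toCoeffs G))
    (hjac : derivT 0 m * derivT q a - derivT 0 a * derivT q m
      = derivT 0 G * derivT q F - derivT 0 F * derivT q G) :
    (fun (n : ℤ) (x : Fin N → ℝ) => mul (dX (toCoeffs m)) (dT q (toCoeffs a)) n x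
        - mul (dX (toCoeffs a)) (dT q (toCoeffs m)) n x)
      = fun (n : ℤ) (x : Fin N → ℝ) =>
          -(dX (truncGe 1 (powC (toCoeffs a) ((q : ℕ) + 1))) n x) := by
  have hlow : derivT 0 m * derivT q a - derivT 0 a * derivT q m + derivT 0 (a ^ ((q : ℕ) + 1))
      = derivT q a + (derivT 0 s * derivT q a - derivT 0 a * derivT q s) := by
    have h := orlovPoly_bracket_time (derivT 0) (derivT q) timeVar a s 0 q (derivT_timeVar 0)
      (derivT_timeVar q)
    rwa [← hm, Fin.val_zero, zero_add, pow_one] at h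
  have hGE : DegGE 1 (toCoeffs (derivT 0 m * derivT q a - derivT 0 a * derivT q m)) := by
    rw [hjac, map_sub, toCoeffs_mul, toCoeffs_mul]
    exact ((hG.dT 0).mul (hF.dT q)).sub ((hF.dT 0).mul (hG.dT q))
  have hLE : DegLE 0 (toCoeffs (derivT 0 m * derivT q a - derivT 0 a * derivT q m
      + derivT 0 (a ^ ((q : ℕ) + 1)))) := by
    rw [hlow, map_add, map_sub, toCoeffs_mul, toCoeffs_mul]
    exact (ha q).add ((((hs.dT 0).mul (ha q)).mono (by norm_num)).sub
      (((ha 0).mul (hs.dT q)).mono (by norm_num)))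
  ext n x
  have hZ : mul (dX (toCoeffs m)) (dT q (toCoeffs a)) n x
      - mul (dX (toCoeffs a)) (dT q (toCoeffs m)) n x
      = toCoeffs (derivT 0 m * derivT q a - derivT 0 a * derivT q m) n x := by
    rw [map_sub, toCoeffs_mul, toCoeffs_mul]
    rfl
  rw [hZ, dX, dT, truncGe]
  split_ifs with hn
  · have h := congrFun (hLE n (by omega)) x
    rw [map_add, Pi.add_apply, Pi.add_apply, toCoeffs_derivT, toCoeffs_pow] at h
    exact eq_neg_of_add_eq_zero_left h
  · rw [hGE n (by omega), pd_zero]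
    simp

theorem orlov_bracket_P (q : Fin N)
    {a m s F G : SmoothSeries N}
    (ha : DegLE 0 (toCoeffs (derivT q a)))
    (ha' : DegLE 1 (toCoeffs a)) (hs : DegLE (-1) (toCoeffs s)) (hm : m = orlovPoly timeVar a + s)
    (hF : DegGE 1 (toCoeffs F)) (hG : DegGE 0 (toCoeffs G))
    (hjac : derivP m * derivT q a - derivP a * derivT q m
      = derivP G * derivT q F - derivP F * derivT q G) :
    (fun (n : ℤ) (x : Fin N → ℝ) => mul (dP (toCoeffs m)) (dT q (toCoeffs a)) n x
        - mul (dP (toCoeffs a)) (dT q (toCoeffs m)) n x)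
      = fun (n : ℤ) (x : Fin N → ℝ) =>
          -(dP (truncGe 1 (powC (toCoeffs a) ((q : ℕ) + 1))) n x) := by
  have hlow : derivP m * derivT q a - derivP a * derivT q m + derivP (a ^ ((q : ℕ) + 1))
      = derivP s * derivT q a - derivP a * derivT q s := by
    rw [hm]
    exact orlovPoly_bracket_const derivP (derivT q) timeVar a s q derivP_timeVar (derivT_timeVar q)
  have hGE : DegGE 0 (toCoeffs (derivP m * derivT q a - derivP a * derivT q m)) := by
    rw [hjac, map_sub, toCoeffs_mul, toCoeffs_mul, toCoeffs_derivP, toCoeffs_derivP]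
    have h1 := (hG.dP (b := -1) (by norm_num)).mul (hF.dT q)
    have h2 := (hF.dP (b := 0) (by norm_num)).mul (hG.dT q)
    exact h1.sub h2
  have hLE : DegLE (-1) (toCoeffs (derivP m * derivT q a - derivP a * derivT q m
      + derivP (a ^ ((q : ℕ) + 1)))) := by
    rw [hlow, map_sub, toCoeffs_mul, toCoeffs_mul, toCoeffs_derivP, toCoeffs_derivP]
    have h1 := (hs.dP (b := -1) (by norm_num)).mul ha
    have h2 := (ha'.dP (b := 0) (by norm_num)).mul (hs.dT q)
    exact h1.sub h2
  ext n x
  have hZ : mul (dP (toCoeffs m)) (dT q (toCoeffs a)) n x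
      - mul (dP (toCoeffs a)) (dT q (toCoeffs m)) n x
      = toCoeffs (derivP m * derivT q a - derivP a * derivT q m) n x := by
    rw [map_sub, toCoeffs_mul, toCoeffs_mul, toCoeffs_derivP, toCoeffs_derivP]
    rfl
  rw [hZ, dP, truncGe]
  split_ifs with hn
  · have h := congrFun (hLE n (by omega)) x
    rw [map_add, Pi.add_apply, Pi.add_apply, toCoeffs_derivP, toCoeffs_pow] at h
    exact eq_neg_of_add_eq_zero_left h
  · rw [hGE n (by omega)]
    simp

/-- under the twistor data conditions, for each time `T_q`
(`q : Fin N` labels `T_{q+1}`, paired with the exponent `q+1`):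
`M_X μ_{T_q} - μ_X M_{T_q} = -∂_X((μ^q)_{≥1})` and
`M_P μ_{T_q} - μ_P M_{T_q} = -∂_P((μ^q)_{≥1})`. -/
theorem statement19 {N : ℕ} [NeZero N] (mu muinv : Coeffs N)
    (hmu : IsLaurent mu) (hshape : IsDMKPShape mu)
    (hmuinv : IsLaurent muinv) (hinv : mul mu muinv = one') (hinv' : mul muinv mu = one')
    (S : ℕ → (Fin N → ℝ) → ℝ) (hS : ∀ i : ℕ, ContDiff ℝ (⊤ : ℕ∞) (S i))
    (M : Coeffs N) (hM : M = orlov mu muinv S)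
    (f g : ℤ →₀ Polynomial ℝ)
    (hcanon : pb (polyToCoeffs (N := N) f) (polyToCoeffs g) = one')
    (hf : truncLe 0 (substC f mu muinv M) = 0)
    (hg : truncLe (-1) (substC g mu muinv M) = 0) :
    ∀ q : Fin N,
      ((fun (n : ℤ) (x : Fin N → ℝ) =>
          mul (dX M) (dT q mu) n x - mul (dX mu) (dT q M) n x)
        = fun (n : ℤ) (x : Fin N → ℝ) =>
            -(dX (truncGe 1 (powC mu ((q : ℕ) + 1))) n x)) ∧
      ((fun (n : ℤ) (x : Fin N → ℝ) =>
          mul (dP M) (dT q mu) n x - mul (dP mu) (dT q M) n x)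
        = fun (n : ℤ) (x : Fin N → ℝ) =>
            -(dP (truncGe 1 (powC mu ((q : ℕ) + 1))) n x)) := by
  intro q
  have hdeg : DegLE (-1) muinv := hshape.degLE_inv hmuinv.1 hinv
  have hmu1 : DegLE 1 mu := fun n hn => hshape.2 n (by omega)
  obtain ⟨hσ, hσdeg⟩ := isLaurent_tsum_smul_powC hmuinv hdeg hS
  obtain ⟨s, hs⟩ := hσ.exists_toCoeffs_eq
  rw [← hs] at hσdeg
  obtain ⟨a, rfl⟩ := hmu.exists_toCoeffs_eq
  obtain ⟨b, rfl⟩ := hmuinv.exists_toCoeffs_eq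
  have hab : a * b = 1 := toCoeffs_injective (by rw [toCoeffs_mul, hinv, toCoeffs_one])
  let u : (SmoothSeries N)ˣ := ⟨a, b, hab, by rw [mul_comm, hab]⟩
  let m : SmoothSeries N := orlovPoly timeVar a + s
  have hm : toCoeffs m = M := by
    rw [hM]
    ext n x
    have hs' := congrFun (congrFun hs n) x
    rw [orlov, ← hs', map_add, orlovPoly, map_sum, Pi.add_apply, Pi.add_apply, Finset.sum_apply,
      Finset.sum_apply]
    congr 1
    refine Finset.sum_congr rfl fun r _ => ?_
    rw [← nsmul_eq_mul, map_nsmul, Pi.smul_apply, Pi.smul_apply, toCoeffs_timeVar_mul, toCoeffs_pow,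
      nsmul_eq_mul, mul_assoc]
  rw [← hm] at hf hg ⊢
  set F := laurentSubst u m (.ofCoeff f) with hFdef
  set G := laurentSubst u m (.ofCoeff g) with hGdef
  have hF : DegGE 1 (toCoeffs F) := fun n hn => by
    have h := congrFun hf n
    rw [truncLe, if_pos (by omega)] at h
    rw [hFdef, toCoeffs_laurentSubst]
    exact h
  have hG : DegGE 0 (toCoeffs G) := fun n hn => by
    have h := congrFun hg n
    rw [truncLe, if_pos (by omega)] at h
    rw [hGdef, toCoeffs_laurentSubst]
    exact h
  have hbr := laurentDeriv_bracket_eq_one f g hcanon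
  have hmuT : ∀ r : Fin N, DegLE 0 (toCoeffs (derivT r a)) := fun r n hn => by
    rw [toCoeffs_derivT, dT]
    by_cases h1 : n = 1
    · rw [h1, hshape.1]
      ext x
      simp [pd]
    · rw [hmu1 n (by omega), pd_zero]
  exact ⟨orlov_bracket_time q hmuT hσdeg rfl hF hG
      (jacobian_laurentSubst (derivT 0) (derivT q) u m _ _ hbr),
    orlov_bracket_P q (hmuT q) hmu1 hσdeg rfl hF hG
      (jacobian_laurentSubst derivP (derivT q) u m _ _ hbr)⟩

end DMKP
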